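/- Let k be an algebraically closed field of characteristic 0. Then the absolute Galois group of the Laurent series field k((t)) is topologically generated by a single element: there exists an automorphism σ in Gal(k((t))‾/k((t))) such that the subgroup generated by σ is dense. -/

import Mathlib

open Polynomial

theorem aux_precomplete {A B : Type*} [CommRing A] (I : Ideal A)
    [IsAdicComplete I A] [AddCommGroup B] [Module A B] [Module.Finite A B] : IsPrecomplete I B := by
  rw [← AdicCompletion.of_surjective_iff]
  intro y
  obtain ⟨z, rfl⟩ := AdicCompletion.ofTensorProduct_surjective_of_finite I B y
  induction z using TensorProduct.induction_on with
  | zero => exact ⟨0, by simp⟩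
  | tmul a m =>
    obtain ⟨a, rfl⟩ := AdicCompletion.of_surjective I A a
    refine ⟨a • m, ?_⟩
    ext n
    simp
    rfl
  | add x y hx hy =>
    obtain ⟨x', hx⟩ := hx
    obtain ⟨y', hy⟩ := hy
    exact ⟨x' + y', by rw [map_add, hx, hy, map_add]⟩

theorem aux_henselian {A B : Type*} [CommRing A] [IsNoetherianRing A] [IsDomain A] (I : Ideal A)
    (hI : I ≠ ⊤)
    [IsAdicComplete I A] [CommRing B] [Algebra A B] [Module.IsTorsionFree A B] [Module.Finite A B] :
    HenselianRing B (I.map (algebraMap A B)) := by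
  have h1 : IsPrecomplete I B := aux_precomplete I
  have h2 : IsHausdorff I B := IsHausdorff.of_isTorsionFree I B hI
  have h3 : IsAdicComplete I B := ⟨⟩
  have h4 : IsAdicComplete (I.map (algebraMap A B)) B := (IsAdicComplete.map_algebraMap_iff _ _).mpr h3
  infer_instance

theorem aux_local {B : Type*} [CommRing B] [IsDedekindDomain B] (J : Ideal B) (hJ : J ≠ ⊤)
    (hJ0 : J ≠ ⊥) [HenselianRing B J] : IsLocalRing B := by
  obtain ⟨P, hP, hJP⟩ := Ideal.exists_le_maximal J hJ
  have hP0 : P ≠ ⊥ := fun h => hJ0 (le_bot_iff.mp (h ▸ hJP))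
  have hPp : Prime P := Ideal.prime_of_isPrime hP0 hP.isPrime
  obtain ⟨e, J', hnd, hJe⟩ := (FiniteMultiplicity.of_not_isUnit hPp.not_isUnit hJ0).exists_eq_pow_mul_and_not_dvd |> fun ⟨c, h1, h2⟩ => (⟨_, c, h2, h1⟩ : ∃ (e : ℕ) (J' : Ideal B), ¬ P ∣ J' ∧ J = P ^ e * J')
  have hcop : IsCoprime (P ^ e) J' := by
    apply IsCoprime.pow_left
    rw [Ideal.isCoprime_iff_sup_eq]
    refine hP.1.2 _ (lt_of_le_of_ne le_sup_left fun h => hnd ?_)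
    rw [Ideal.dvd_iff_le, h]; exact le_sup_right
  obtain ⟨x, hx, y, hy, hxy⟩ := Ideal.isCoprime_iff_exists.mp hcop
  have hxyJ : x * y ∈ J := hJe ▸ Ideal.mul_mem_mul hx hy
  have he : e ≠ 0 := by
    rintro rfl
    rw [pow_zero, one_mul] at hJe
    exact hnd (hJe ▸ Ideal.dvd_iff_le.mpr hJP)
  obtain ⟨z, hz, hzy⟩ := HenselianRing.is_henselian (I := J) (X ^ 2 - X : B[X]) (by monicity!) y
    (by
      have : eval y (X ^ 2 - X : B[X]) = - (x * y) := by
        simp; linear_combination y * hxy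
      rw [this]; exact neg_mem hxyJ)
    (by
      refine IsUnit.of_mul_eq_one (Ideal.Quotient.mk J (derivative (X ^ 2 - X : B[X])|>.eval y)) ?_
      rw [← map_mul, ← map_one (Ideal.Quotient.mk J), Ideal.Quotient.eq]
      have : eval y (derivative (X ^ 2 - X : B[X])) * eval y (derivative (X ^ 2 - X : B[X])) - 1 = -4 * (x * y) := by
        simp; linear_combination 4 * y * hxy
      rw [this]; exact J.mul_mem_left _ hxyJ)
  have hz' : z * (z - 1) = 0 := by
    have := hz; simp [IsRoot] at this; linear_combination this
  have hxP : x ∈ P := Ideal.pow_le_self he hx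
  have hJ't : J' = ⊤ := by
    rcases mul_eq_zero.mp hz' with h | h
    · exfalso
      have : y ∈ P := by
        have := P.neg_mem (hJP hzy); simpa [h] using this
      exact hP.ne_top ((Ideal.eq_top_iff_one _).mpr (hxy ▸ P.add_mem hxP this))
    · have h1 : z = 1 := sub_eq_zero.mp h
      rw [Ideal.eq_top_iff_one]
      have h2 : z - y ∈ J' := (hJe ▸ Ideal.mul_le_right : J ≤ J') hzy
      have := J'.add_mem h2 hy
      simpa [h1] using this
  rw [hJ't, Ideal.mul_top] at hJe
  refine IsLocalRing.of_unique_max_ideal ⟨P, hP, fun Q hQ => ?_⟩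
  have : J ≤ Q := (HenselianRing.jac (I := J)).trans (by
    rw [Ideal.jacobson_bot]; exact Ring.jacobson_le_of_isMaximal Q)
  rw [hJe] at this
  exact (hP.eq_of_le hQ.ne_top ((hQ.isPrime.pow_le_iff he).mp this)).symm

/-- Roots of units congruent to one. -/
theorem aux_root {B : Type*} [CommRing B] (J : Ideal B) [HenselianRing B J] (n : ℕ) (hn : n ≠ 0)
    (hu : IsUnit (n : B)) (v : B) (hv : ∃ m, (v - 1) ^ m ∈ J) : ∃ w : B, w ^ n = v := by
  let f : B[X] := X ^ n - C v
  have hf : f.Monic := monic_X_pow_sub_C v hn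
  obtain ⟨m, hm⟩ := hv
  have hnil : IsNilpotent (Ideal.Quotient.mk J (v - 1)) :=
    ⟨m, by rw [← map_pow]; exact Ideal.Quotient.eq_zero_iff_mem.mpr hm⟩
  obtain ⟨r, ⟨hr, hr0⟩, -⟩ := existsUnique_nilpotent_sub_and_aeval_eq_zero (R := B) (S := B ⧸ J) (x := (1 : B ⧸ J)) (P := f)
    (by 
      have : aeval (1 : B ⧸ J) f = - Ideal.Quotient.mk J (v - 1) := by
        simp [f]
      rw [this]; exact hnil.neg) 
    (by simpa [f, derivative_X_pow] using hu.map (Ideal.Quotient.mk J))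
  obtain ⟨s, rfl⟩ := Ideal.Quotient.mk_surjective r
  have hs : s ^ n - v ∈ J := by
    rw [← Ideal.Quotient.eq_zero_iff_mem]; simpa [f] using hr0
  have hsu : IsUnit (Ideal.Quotient.mk J s) := by
    have := hr.isUnit_one_sub 
    simpa using this
  obtain ⟨w, hw, -⟩ := HenselianRing.is_henselian (I := J) f hf s (by simpa [f] using hs)
    (by simpa [f, derivative_X_pow] using (hu.map (Ideal.Quotient.mk J)).mul (hsu.pow _))
  exact ⟨w, by simpa [f, IsRoot, sub_eq_zero] using hw⟩

open PowerSeries IsLocalRing in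
theorem aux_main (k : Type*) [Field k] [IsAlgClosed k] [CharZero k] (L : Type*) [Field L]
    [Algebra (LaurentSeries k) L] [FiniteDimensional (LaurentSeries k) L] :
    ∃ a : L, a ^ (Module.finrank (LaurentSeries k) L) =
      algebraMap (LaurentSeries k) L (algebraMap (PowerSeries k) (LaurentSeries k) PowerSeries.X) := by
  let A := PowerSeries k
  let K := LaurentSeries k
  let _ : Algebra A L := ((algebraMap K L).comp (algebraMap A K)).toAlgebra
  have : IsScalarTower A K L := IsScalarTower.of_algebraMap_eq fun _ => rfl
  have : CharZero K := charZero_of_injective_algebraMap (algebraMap k K).injective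
  let B := integralClosure A L
  have : Module.IsTorsionFree A L := Module.IsTorsionFree.trans_faithfulSMul A K L
  have : Module.Finite A B := IsIntegralClosure.finite A K L B
  have : IsDedekindDomain B := integralClosure.isDedekindDomain A K L
  have : IsFractionRing B L := integralClosure.isFractionRing_of_finite_extension K L
  have : Module.IsTorsionFree A B := IsIntegralClosure.isTorsionFree A L
  set I : Ideal A := Ideal.span {PowerSeries.X} with hIdef
  have hIm : I = maximalIdeal A := PowerSeries.maximalIdeal_eq_span_X.symm
  have hImax : I.IsMaximal := hIm ▸ maximalIdeal.isMaximal A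
  have hI0 : I ≠ ⊥ := by
    rw [hIdef, Ne, Ideal.span_singleton_eq_bot]; exact PowerSeries.X_ne_zero
  have hinj : Function.Injective (algebraMap A B) := FaithfulSMul.algebraMap_injective A B
  set J := I.map (algebraMap A B) with hJ
  have : HenselianRing B J := aux_henselian I hImax.ne_top
  have hJ0 : J ≠ ⊥ := by
    rw [hJ, Ne, Ideal.map_eq_bot_iff_of_injective hinj]; exact hI0
  have hJt : J ≠ ⊤ := by
    intro h
    obtain ⟨Q, hQ⟩ := Ideal.exists_ideal_over_maximal_of_isIntegral (S := B) I
      (by rw [(RingHom.injective_iff_ker_eq_bot _).mp hinj]; exact bot_le)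
    have : J ≤ Q := Ideal.map_le_iff_le_comap.mpr hQ.2.ge
    exact hQ.1.ne_top (top_le_iff.mp (h ▸ this))
  have : IsLocalRing B := aux_local J hJt hJ0
  have hfund := Ideal.ramificationIdx_mul_inertiaDeg_of_isLocalRing B K L hI0
  have hle : J ≤ maximalIdeal B := le_maximalIdeal hJt
  have hlies : (maximalIdeal B).LiesOver I := ⟨hImax.eq_of_le (Ideal.comap_ne_top _ (maximalIdeal.isMaximal B).ne_top)
    (Ideal.map_le_iff_le_comap.mp hle)⟩
  let φ : k →+* ResidueField B :=
    (residue B).comp ((algebraMap A B).comp (PowerSeries.C (R := k)))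
  have hφ : φ.comp (PowerSeries.constantCoeff (R := k)) = (residue B).comp (algebraMap A B) := by
    ext a
    have h1 : a - PowerSeries.C (PowerSeries.constantCoeff a) ∈ I := by
      rw [hIdef, Ideal.mem_span_singleton, PowerSeries.X_dvd_iff]; simp
    have h2 : residue B (algebraMap A B (a - PowerSeries.C (PowerSeries.constantCoeff a))) = 0 :=
      (residue_eq_zero_iff _).mpr (hle (Ideal.mem_map_of_mem _ h1))
    rw [map_sub, map_sub, sub_eq_zero] at h2
    exact h2.symm
  have hφi : φ.IsIntegral := by
    have h1 : ((residue B).comp (algebraMap A B)).IsIntegral :=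
      RingHom.IsIntegral.trans _ _ (algebraMap_isIntegral_iff.mpr inferInstance)
        (RingHom.isIntegral_of_surjective _ (residue_surjective (R := B)))
    rw [← hφ] at h1
    exact RingHom.IsIntegral.tower_top _ _ h1
  have hres : Function.Surjective φ := (IsAlgClosed.ringHom_bijective_of_isIntegral φ hφi).2
  have hf : I.inertiaDeg' (maximalIdeal B) = 1 := by
    rw [Ideal.inertiaDeg'_algebraMap]
    let _ := Ideal.Quotient.field I
    refine finrank_eq_one (1 : B ⧸ maximalIdeal B) one_ne_zero fun w => ?_
    obtain ⟨c, hc⟩ := hres w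
    refine ⟨Ideal.Quotient.mk I (PowerSeries.C c), ?_⟩
    rw [← hc, Algebra.smul_def, mul_one]
    rfl
  rw [hf, mul_one] at hfund
  have hmb : maximalIdeal B ≠ ⊥ := fun h => hJ0 (le_bot_iff.mp (h ▸ hle))
  have hpid : IsPrincipalIdealRing B :=
    IsPrincipalIdealRing.of_finite_maximals (by
      refine (Set.finite_singleton (maximalIdeal B)).subset fun Q hQ => ?_
      exact IsLocalRing.eq_maximalIdeal hQ)
  have hdvr : IsDiscreteValuationRing B := { not_a_field' := hmb }
  obtain ⟨ϖ, hϖ⟩ := IsDiscreteValuationRing.exists_irreducible B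
  have hmax : maximalIdeal B = Ideal.span {ϖ} := hϖ.maximalIdeal_eq
  set t : B := algebraMap A B PowerSeries.X with ht
  have hJs : J = Ideal.span {t} := by rw [hJ, hIdef, Ideal.map_span, Set.image_singleton]
  have ht0 : t ≠ 0 := fun h => hJ0 (by rw [hJs, h]; simp)
  obtain ⟨n, u, htu⟩ := IsDiscreteValuationRing.eq_unit_mul_pow_irreducible ht0 hϖ
  have hJn : J = maximalIdeal B ^ n := by
    rw [hJs, htu, hmax, Ideal.span_singleton_pow, Ideal.span_singleton_mul_left_unit u.isUnit]
  have hram : I.ramificationIdx' (maximalIdeal B) = n := by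
    refine Ideal.ramificationIdx'_spec (hJn ▸ le_rfl) fun h => ?_
    change J ≤ _ at h
    rw [hJs, hmax, Ideal.span_singleton_pow, Ideal.span_singleton_le_span_singleton, htu, pow_succ'] at h
    have h3 := (mul_dvd_mul_iff_right (pow_ne_zero n hϖ.ne_zero)).mp h
    exact hϖ.not_isUnit (isUnit_of_dvd_unit h3 u.isUnit)
  rw [hram] at hfund
  have hn : n ≠ 0 := hfund ▸ (Module.finrank_pos (R := K) (M := L)).ne'
  obtain ⟨c, hc⟩ := hres (residue B u)
  have hc0 : c ≠ 0 := by
    rintro rfl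
    rw [map_zero] at hc
    exact (u.isUnit.map (residue B)).ne_zero hc.symm
  obtain ⟨d, hd⟩ := IsAlgClosed.exists_pow_nat_eq c (Nat.pos_of_ne_zero hn)
  let ψ : k →+* B := (algebraMap A B).comp (PowerSeries.C (R := k))
  have hun : IsUnit (n : B) := by
    have : IsUnit (n : k) := (Nat.cast_ne_zero.mpr hn).isUnit
    simpa using this.map ψ
  have hv : (u : B) * ψ c⁻¹ - 1 ∈ maximalIdeal B := by
    rw [← residue_eq_zero_iff, map_sub, map_mul, map_one, ← hc]
    change φ c * φ c⁻¹ - 1 = 0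
    rw [← map_mul, mul_inv_cancel₀ hc0, map_one, sub_self]
  obtain ⟨w, hw⟩ := aux_root J n hn hun ((u : B) * ψ c⁻¹)
    ⟨n, by rw [hJn]; exact Ideal.pow_mem_pow hv n⟩
  have hfin : (ϖ * w * ψ d) ^ n = t := by
    rw [mul_pow, mul_pow, hw, ← map_pow, hd, htu]
    have : ψ c⁻¹ * ψ c = 1 := by rw [← map_mul, inv_mul_cancel₀ hc0, map_one]
    linear_combination (ϖ ^ n * u) * this
  refine ⟨((ϖ * w * ψ d : B) : L), ?_⟩
  change _ ^ (Module.finrank K L) = _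
  rw [← hfund]
  have := congrArg (algebraMap B L) hfin
  rw [map_pow] at this
  exact this

theorem aux_irred (k : Type*) [Field k] (n : ℕ) (hn : n ≠ 0) :
    Irreducible (X ^ n - C (algebraMap (PowerSeries k) (LaurentSeries k) PowerSeries.X) :
      (LaurentSeries k)[X]) := by
  have hmon : (X ^ n - C PowerSeries.X : (PowerSeries k)[X]).Monic := monic_X_pow_sub_C _ hn
  have hdeg : (X ^ n - C PowerSeries.X : (PowerSeries k)[X]).degree = n :=
    degree_X_pow_sub_C (Nat.pos_of_ne_zero hn) _
  have hprime : (Ideal.span {(PowerSeries.X : PowerSeries k)}).IsPrime :=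
    PowerSeries.span_X_isPrime
  have h : Irreducible (X ^ n - C PowerSeries.X : (PowerSeries k)[X]) := by
    refine irreducible_of_eisenstein_criterion hprime ?_ ?_ ?_ ?_ hmon.isPrimitive
    · rw [hmon.leadingCoeff]
      exact fun h => hprime.ne_top ((Ideal.eq_top_iff_one _).mpr h)
    · intro m hm
      rw [hdeg, Nat.cast_lt] at hm
      rw [coeff_sub, coeff_X_pow, if_neg hm.ne, zero_sub, coeff_C]
      split_ifs
      · exact neg_mem (Ideal.mem_span_singleton_self _)
      · simp
    · rw [hdeg]; exact_mod_cast Nat.pos_of_ne_zero hn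
    · rw [coeff_sub, coeff_X_pow, if_neg hn.symm, zero_sub, coeff_C_zero, neg_mem_iff,
        Ideal.span_singleton_pow, Ideal.mem_span_singleton, PowerSeries.X_pow_dvd_iff]
      intro h
      simpa using h 1 (by norm_num)
  have := (hmon.irreducible_iff_irreducible_map_fraction_map (K := LaurentSeries k)).mp h
  simpa using this

theorem aux_open {K L : Type*} [Field K] [Field L] [Algebra K L] [Algebra.IsIntegral K L]
    (a : L) (s : Set L) : IsOpen {σ : L ≃ₐ[K] L | σ a ∈ s} := by
  rw [isOpen_iff_mem_nhds]
  intro σ hσ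
  have h1 : IsOpen ((fun τ : L ≃ₐ[K] L => σ⁻¹ * τ) ⁻¹' (MulAction.stabilizer (L ≃ₐ[K] L) a)) :=
    (stabilizer_isOpen_of_isIntegral a).preimage (continuous_const_mul σ⁻¹)
  refine Filter.mem_of_superset (h1.mem_nhds (by simp)) fun τ hτ => ?_
  have h2 : (σ⁻¹ * τ) a = a := hτ
  have h3 : τ a = σ a := by
    have := congrArg σ h2
    rw [← AlgEquiv.mul_apply, mul_inv_cancel_left] at this
    exact this
  change τ a ∈ s
  rw [h3]; exact hσ

/-- For an algebraically closed field `k` of characteristic 0, the absolute Galois group of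
the Laurent series field `k((t))` is topologically generated by a single element. -/
theorem absoluteGaloisGroup_laurentSeries_topologically_cyclic
    (k : Type*) [Field k] [IsAlgClosed k] [CharZero k] :
    ∃ σ : AlgebraicClosure (LaurentSeries k) ≃ₐ[LaurentSeries k]
        AlgebraicClosure (LaurentSeries k),
      (Subgroup.closure {σ}).topologicalClosure = ⊤ := by
  let K := LaurentSeries k
  let Ω := AlgebraicClosure K
  let x0 : K := algebraMap (PowerSeries k) K PowerSeries.X
  let T : Ω := algebraMap K Ω x0
  have : CharZero K := charZero_of_injective_algebraMap (algebraMap k K).injective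
  have : IsGalois K Ω := {}
  have hx0 : x0 ≠ 0 := by
    intro h
    exact PowerSeries.X_ne_zero ((map_eq_zero_iff _ (IsFractionRing.injective (PowerSeries k) K)).mp h)
  have hT : T ≠ 0 := (_root_.map_ne_zero _).mpr hx0
  let S : ℕ+ → Set (Ω ≃ₐ[K] Ω) := fun n =>
    {σ | ∀ a : Ω, a ^ (n : ℕ) = T → IsPrimitiveRoot (σ a / a) n}
  have hdiv : ∀ n d : ℕ+, S (n * d) ⊆ S n := by
    intro n d σ hσ a ha
    obtain ⟨b, hb⟩ := IsAlgClosed.exists_pow_nat_eq a d.pos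
    have h1 := hσ b (by rw [PNat.mul_coe, mul_comm, pow_mul, hb, ha])
    have h2 := h1.pow (n * d).pos (a := d) (b := n) (by rw [PNat.mul_coe, mul_comm])
    rwa [div_pow, ← map_pow, hb] at h2
  have hdir : Directed (· ⊇ ·) S := fun n d => ⟨n * d, hdiv n d, by rw [mul_comm]; exact hdiv d n⟩
  have hclosed : ∀ n, IsClosed (S n) := by
    intro n
    have : S n = ⋂ a : Ω, ⋂ _ : a ^ (n : ℕ) = T, {σ : Ω ≃ₐ[K] Ω | IsPrimitiveRoot (σ a / a) n} := by
      ext σ; simp [S]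
    rw [this]
    refine isClosed_iInter fun a => isClosed_iInter fun _ => ⟨?_⟩
    exact aux_open (K := K) a {y | ¬ IsPrimitiveRoot (y / a) n}
  have hne : ∀ n, (S n).Nonempty := by
    intro n
    obtain ⟨a, ha⟩ := IsAlgClosed.exists_pow_nat_eq T n.pos
    have : NeZero ((n : ℕ) : k) := ⟨Nat.cast_ne_zero.mpr n.ne_zero⟩
    obtain ⟨ζ, hζ⟩ := HasEnoughRootsOfUnity.exists_primitiveRoot k n
    have hζK : IsPrimitiveRoot (algebraMap k K ζ) n :=
      hζ.map_of_injective (algebraMap k K).injective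
    set z : Ω := algebraMap K Ω (algebraMap k K ζ) with hz
    have hzp : IsPrimitiveRoot z n := hζK.map_of_injective (algebraMap K Ω).injective
    have hirr := aux_irred k n n.ne_zero
    have hmin : X ^ (n : ℕ) - C x0 = minpoly K a :=
      minpoly.eq_of_irreducible_of_monic hirr (by simp [ha, T]) (monic_X_pow_sub_C _ n.ne_zero)
    have hconj : IsConjRoot K a (z * a) := by
      refine (isConjRoot_iff_aeval_eq_zero (Algebra.IsIntegral.isIntegral a)).mpr ?_
      rw [← hmin]
      simp [mul_pow, hzp.pow_eq_one, ha, T]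
    obtain ⟨σ, hσ⟩ := isConjRoot_iff_exists_algEquiv.mp hconj.symm
    have ha0 : a ≠ 0 := by
      rintro rfl
      exact hT (by rw [← ha, zero_pow n.ne_zero])
    refine ⟨σ, fun b hb => ?_⟩
    have hba : (b / a) ^ (n : ℕ) = 1 := by rw [div_pow, ha, hb, div_self hT]
    obtain ⟨i, -, hi⟩ := hzp.eq_pow_of_pow_eq_one hba
    have hb' : b = z ^ i * a := by rw [hi, div_mul_cancel₀ _ ha0]
    have hz0 : z ≠ 0 := hzp.ne_zero n.ne_zero
    have hσz : σ z = z := σ.commutes _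
    have : σ b / b = z := by
      rw [hb', map_mul, map_pow, hσz, hσ]
      rw [mul_left_comm]
      exact mul_div_cancel_right₀ z (mul_ne_zero (pow_ne_zero i hz0) ha0)
    rw [this]; exact hzp
  obtain ⟨σ, hσ⟩ := IsCompact.nonempty_iInter_of_directed_nonempty_isCompact_isClosed S hdir hne
    (fun n => (hclosed n).isCompact) hclosed
  rw [Set.mem_iInter] at hσ
  refine ⟨σ, ?_⟩
  let H : ClosedSubgroup (Ω ≃ₐ[K] Ω) :=
    ⟨(Subgroup.closure {σ}).topologicalClosure, Subgroup.isClosed_topologicalClosure _⟩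
  have hbot : IntermediateField.fixedField H.1 = (⊥ : IntermediateField K Ω) := by
    rw [eq_bot_iff]
    intro x hx
    have hσx : σ x = x := hx ⟨σ, Subgroup.le_topologicalClosure _ (Subgroup.mem_closure_singleton_self σ)⟩
    have hint : IsIntegral K x := Algebra.IsIntegral.isIntegral x
    let L := IntermediateField.adjoin K {x}
    have : FiniteDimensional K L := IntermediateField.adjoin.finiteDimensional hint
    obtain ⟨a, ha⟩ := aux_main k L
    let n : ℕ+ := ⟨Module.finrank K L, Module.finrank_pos⟩
    have hσa : σ (a : Ω) = a := 
      (IntermediateField.forall_mem_adjoin_smul_eq_self_iff K (S := {x}) σ).mpr (by simpa using hσx) a a.2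
    have haT : (a : Ω) ^ (n : ℕ) = T := congrArg (algebraMap L Ω) ha
    have ha0 : (a : Ω) ≠ 0 := by
      intro h
      exact hT (by rw [← haT, h, zero_pow n.ne_zero])
    have h1 := hσ n a haT
    rw [hσa, div_self ha0] at h1
    have h2 : (n : ℕ) = 1 := h1.unique IsPrimitiveRoot.one
    have h3 : L = ⊥ := IntermediateField.finrank_eq_one_iff.mp h2
    rw [← h3]
    exact IntermediateField.mem_adjoin_simple_self K x
  have := InfiniteGalois.fixingSubgroup_fixedField H
  rw [hbot, IntermediateField.fixingSubgroup_bot] at this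
  exact this.symm
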